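/- Let $R$ be a commutative ring and let $a, b : \mathbb{N} \to R$ be sequences with $a(0) = b(0) = 1$. Define the transform $F$ by $F(a)(n) = \prod_{p \text{ prime},\ p \mid n} a(\nu_p(n))$ for $n \geq 1$ (so $F(a)(1) = 1$), where $\nu_p(n)$ is the $p$-adic valuation of $n$. Let $c = a * b$ be the Cauchy product, $c(n) = \sum_{h=0}^{n} a(h) b(n-h)$. Then for every $n \geq 1$: $F(c)(n) = \sum_{d \mid n} F(a)(d)\, F(b)(n/d)$, i.e. $F(a*b) = F(a) \odot F(b)$ where $\odot$ is the Dirichlet convolution. -/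

import Mathlib

open Finset

/-- The transform `F`: `Fseq a n = ∏_{p prime, p ∣ n} a (ν_p n)`. -/
def Fseq {R : Type*} [CommRing R] (a : ℕ → R) (n : ℕ) : R :=
  ∏ p ∈ n.primeFactors, a (n.factorization p)

theorem Fseq_mul_of_coprime {R : Type*} [CommRing R] (a : ℕ → R) {m n : ℕ}
    (h : m.Coprime n) : Fseq a (m * n) = Fseq a m * Fseq a n := by
  change (m * n).factorization.prod (fun _ k => a k) =
    m.factorization.prod (fun _ k => a k) * n.factorization.prod (fun _ k => a k)
  rw [Nat.factorization_mul_of_coprime h]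
  exact Finsupp.prod_add_index_of_disjoint h.disjoint_primeFactors _

theorem Fseq_prime_pow {R : Type*} [CommRing R] {a : ℕ → R} (ha : a 0 = 1) {p : ℕ}
    (hp : p.Prime) (k : ℕ) : Fseq a (p ^ k) = a k := by
  change (p ^ k).factorization.prod (fun _ k => a k) = a k
  rw [hp.factorization_pow, Finsupp.prod_single_index ha]

/-- `Fseq a` as an arithmetic function, with value `0` at `0`. -/
def FseqArith {R : Type*} [CommRing R] (a : ℕ → R) : ArithmeticFunction R :=
  ⟨fun n => if n = 0 then 0 else Fseq a n, if_pos rfl⟩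

theorem FseqArith_apply {R : Type*} [CommRing R] (a : ℕ → R) {n : ℕ} (hn : n ≠ 0) :
    FseqArith a n = Fseq a n :=
  if_neg hn

theorem isMultiplicative_FseqArith {R : Type*} [CommRing R] (a : ℕ → R) :
    (FseqArith a).IsMultiplicative := by
  rw [ArithmeticFunction.IsMultiplicative.iff_ne_zero]
  refine ⟨by simp [FseqArith_apply, Fseq], fun {m n} hm hn h => ?_⟩
  rw [FseqArith_apply a hm, FseqArith_apply a hn, FseqArith_apply a (mul_ne_zero hm hn),
    Fseq_mul_of_coprime a h]

theorem FseqArith_mul_apply {R : Type*} [CommRing R] (a b : ℕ → R) (n : ℕ) :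
    (FseqArith a * FseqArith b) n = ∑ d ∈ n.divisors, Fseq a d * Fseq b (n / d) := by
  rw [ArithmeticFunction.mul_apply,
    Nat.sum_divisorsAntidiagonal (fun x y => FseqArith a x * FseqArith b y)]
  refine Finset.sum_congr rfl fun d hd => ?_
  have hd' := Nat.pos_of_mem_divisors hd
  rw [FseqArith_apply a hd'.ne',
    FseqArith_apply b (Nat.div_pos (Nat.divisor_le hd) hd').ne']

theorem FseqArith_cauchy_eq_mul {R : Type*} [CommRing R] (a b : ℕ → R)
    (ha : a 0 = 1) (hb : b 0 = 1) :
    FseqArith (fun m => ∑ h ∈ Finset.range (m + 1), a h * b (m - h)) =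
      FseqArith a * FseqArith b := by
  rw [ArithmeticFunction.IsMultiplicative.eq_iff_eq_on_prime_powers _
    (isMultiplicative_FseqArith _) _
    ((isMultiplicative_FseqArith a).mul (isMultiplicative_FseqArith b))]
  intro p k hp
  rw [FseqArith_apply _ (pow_ne_zero k hp.ne_zero), Fseq_prime_pow (by simp [ha, hb]) hp,
    FseqArith_mul_apply, Nat.sum_divisors_prime_pow hp]
  refine Finset.sum_congr rfl fun i hi => ?_
  rw [Nat.pow_div (Finset.mem_range_succ_iff.mp hi) hp.pos, Fseq_prime_pow ha hp,
    Fseq_prime_pow hb hp]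

theorem Fseq_cauchy_eq_dirichlet {R : Type*} [CommRing R] (a b : ℕ → R)
    (ha : a 0 = 1) (hb : b 0 = 1) (n : ℕ) (hn : 1 ≤ n) :
    Fseq (fun m => ∑ h ∈ Finset.range (m + 1), a h * b (m - h)) n =
      ∑ d ∈ n.divisors, Fseq a d * Fseq b (n / d) := by
  rw [← FseqArith_apply _ (Nat.one_le_iff_ne_zero.mp hn), FseqArith_cauchy_eq_mul a b ha hb,
    FseqArith_mul_apply]
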